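/- For every n ≥ 0 and every ballot path p of length n, there exists exactly one ballot path p′ of length n that is UUU-equivalent to p and satisfies all of the following: p′ does not begin with UUDD, p′ contains no occurrence of the factor DUDD and no occurrence of the factor DUUD, p′ contains no occurrence of DUD at height greater than 1, and p′ either ends with UUU, or ends with D, or p′ is the empty path, or p′ = U. -/

import Mathlib

/-- A path is a list of steps: `true` is an up-step U, `false` is a down-step D. -/
abbrev Step := Bool

/-- The height of the `j`-th lattice point of the path `p`. -/
def pathHeight (p : List Bool) (j : ℕ) : ℤ :=
  ((p.take j).count true : ℤ) - ((p.take j).count false : ℤ)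

/-- A ballot path: every prefix has at least as many U's as D's. -/
def IsBallot (p : List Bool) : Prop :=
  ∀ k : ℕ, (p.take k).count false ≤ (p.take k).count true

/-- A Dyck path: a ballot path with equally many U's and D's. -/
def IsDyck (p : List Bool) : Prop :=
  IsBallot p ∧ p.count true = p.count false

/-- The string `τ` occurs at (0-indexed) position `i` of the path `p`. -/
def OccursAt (τ p : List Bool) (i : ℕ) : Prop :=
  (p.drop i).take τ.length = τ

/-- Two paths are `τ`-equivalent: same length and occurrences of `τ` at the same positions. -/
def PathEquiv (τ p q : List Bool) : Prop :=
  p.length = q.length ∧ ∀ i : ℕ, OccursAt τ p i ↔ OccursAt τ q i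

/-- The setoid of `τ`-equivalence on ballot paths of length `n`. -/
def ballotSetoid (τ : List Bool) (n : ℕ) :
    Setoid {p : List Bool // IsBallot p ∧ p.length = n} where
  r p q := PathEquiv τ p.1 q.1
  iseqv := ⟨fun _ => ⟨rfl, fun _ => Iff.rfl⟩,
            fun h => ⟨h.1.symm, fun i => (h.2 i).symm⟩,
            fun h1 h2 => ⟨h1.1.trans h2.1, fun i => (h1.2 i).trans (h2.2 i)⟩⟩

/-- The number of `τ`-equivalence classes of ballot paths of length `n`. -/
noncomputable def numBallotClasses (τ : List Bool) (n : ℕ) : ℕ :=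
  Nat.card (Quotient (ballotSetoid τ n))

/-- The setoid of `τ`-equivalence on Dyck paths of semilength `n`. -/
def dyckSetoid (τ : List Bool) (n : ℕ) :
    Setoid {p : List Bool // IsDyck p ∧ p.length = 2 * n} where
  r p q := PathEquiv τ p.1 q.1
  iseqv := ⟨fun _ => ⟨rfl, fun _ => Iff.rfl⟩,
            fun h => ⟨h.1.symm, fun i => (h.2 i).symm⟩,
            fun h1 h2 => ⟨h1.1.trans h2.1, fun i => (h1.2 i).trans (h2.2 i)⟩⟩

/-- The number of `τ`-equivalence classes of Dyck paths of semilength `n`. -/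
noncomputable def numDyckClasses (τ : List Bool) (n : ℕ) : ℕ :=
  Nat.card (Quotient (dyckSetoid τ n))

theorem occursAt_zero (τ p : List Bool) : OccursAt τ p 0 ↔ τ <+: p := by
  simp [OccursAt, List.prefix_iff_eq_take, eq_comm]

theorem occursAt_cons_succ (τ p : List Bool) (a : Bool) (i : ℕ) :
    OccursAt τ (a :: p) (i + 1) ↔ OccursAt τ p i := by
  simp [OccursAt]

theorem pathEquiv_cons_cons {τ p q : List Bool} {a b : Bool} :
    PathEquiv τ (a :: p) (b :: q) ↔ (τ <+: a :: p ↔ τ <+: b :: q) ∧ PathEquiv τ p q := by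
  constructor
  · rintro ⟨hl, h⟩
    refine ⟨?_, by simpa using hl, fun i => ?_⟩
    · simpa only [occursAt_zero] using h 0
    · simpa only [occursAt_cons_succ] using h (i + 1)
  · rintro ⟨h0, hl, h⟩
    refine ⟨by simpa using hl, fun i => ?_⟩
    cases i with
    | zero => simpa only [occursAt_zero] using h0
    | succ i => simpa only [occursAt_cons_succ] using h i

theorem PathEquiv.symm {τ p q : List Bool} (h : PathEquiv τ p q) : PathEquiv τ q p :=
  ⟨h.1.symm, fun i => (h.2 i).symm⟩

theorem PathEquiv.trans {τ p q r : List Bool} (h : PathEquiv τ p q) (h' : PathEquiv τ q r) :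
    PathEquiv τ p r :=
  ⟨h.1.trans h'.1, fun i => (h.2 i).trans (h'.2 i)⟩

theorem pathEquiv_refl (τ p : List Bool) : PathEquiv τ p p :=
  ⟨rfl, fun _ => Iff.rfl⟩

theorem not_pathEquiv_nil_cons {τ p : List Bool} {a : Bool} : ¬ PathEquiv τ [] (a :: p) :=
  fun h => by simpa using h.1

theorem not_pathEquiv_cons_nil {τ p : List Bool} {a : Bool} : ¬ PathEquiv τ (a :: p) [] :=
  fun h => by simpa using h.1

/-- The number of steps before the first occurrence of UUU, or the length if there is none. -/
def gapLength : List Bool → ℕ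
  | [] => 0
  | a :: l => if [true, true, true] <+: a :: l then 0 else gapLength l + 1

theorem PathEquiv.gapLength_eq {p q : List Bool} (h : PathEquiv [true, true, true] p q) :
    gapLength p = gapLength q := by
  induction p generalizing q with
  | nil =>
    cases q with
    | nil => rfl
    | cons b q => exact absurd h not_pathEquiv_nil_cons
  | cons a p ih =>
    cases q with
    | nil => exact absurd h not_pathEquiv_cons_nil
    | cons b q =>
      obtain ⟨h0, h1⟩ := pathEquiv_cons_cons.1 h
      simp only [gapLength, h0, ih h1]

theorem gapLength_false_cons (l : List Bool) : gapLength (false :: l) = gapLength l + 1 := by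
  simp [gapLength]

theorem gapLength_true_false_cons (l : List Bool) :
    gapLength (true :: false :: l) = gapLength l + 2 := by
  simp [gapLength]

theorem gapLength_eq_zero {l : List Bool} (h : gapLength l = 0) :
    l = [] ∨ ∃ r, l = true :: true :: true :: r := by
  cases l with
  | nil => simp
  | cons a l =>
    right
    have h0 : [true, true, true] <+: a :: l := by
      by_contra h0
      simp [gapLength, h0] at h
    obtain ⟨r, hr⟩ := h0
    exact ⟨r, hr.symm⟩

theorem gapLength_eq_succ {l : List Bool} {k : ℕ} (h : gapLength l = k + 1) :
    ∃ a r, l = a :: r ∧ ¬ [true, true, true] <+: a :: r ∧ gapLength r = k := by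
  cases l with
  | nil => simp [gapLength] at h
  | cons a l =>
    by_cases h0 : [true, true, true] <+: a :: l
    · simp [gapLength, h0] at h
    · exact ⟨a, l, rfl, h0, by simpa [gapLength, h0] using h⟩

/-- The conditions on a canonical representative that can be checked step by step, for a path
starting at height `h`. -/
def IsCanonicalFrom : ℕ → List Bool → Prop
  | _, [] => True
  | h, true :: l => IsCanonicalFrom (h + 1) l
  | h, false :: l => 1 ≤ h ∧ ¬ [true, false, false] <+: l ∧ ¬ [true, true, false] <+: l ∧
      (h ≤ 2 ∨ ¬ [true, false] <+: l) ∧ l ≠ [true] ∧ l ≠ [true, true] ∧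
      IsCanonicalFrom (h - 1) l

theorem isCanonicalFrom_after_down {h : ℕ} {s : List Bool}
    (hs : IsCanonicalFrom h (false :: true :: s)) :
    (∃ r, s = true :: true :: r) ∨
      ∃ r, s = false :: r ∧ ¬ [false] <+: r ∧ h ≤ 2 ∧ IsCanonicalFrom h (false :: r) := by
  obtain ⟨h1, h2, h3, h4, h5, h6, h7⟩ := hs
  match s with
  | [] => simp at h5
  | [true] => simp at h6
  | true :: true :: r => simp
  | true :: false :: r => simp at h3
  | false :: r =>
    right
    refine ⟨r, rfl, by simpa using h2, by simpa using h4, ?_⟩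
    have h8 : IsCanonicalFrom (h - 1 + 1) (false :: r) := h7
    rwa [Nat.sub_add_cancel h1] at h8

theorem IsCanonicalFrom.even_gapLength {h : ℕ} {s : List Bool}
    (hs : IsCanonicalFrom h (false :: s)) (hD : ¬ [false] <+: s) : Even (gapLength s) := by
  match s with
  | [] => simp [gapLength]
  | false :: s => simp at hD
  | true :: s =>
    rcases isCanonicalFrom_after_down hs with ⟨r, rfl⟩ | ⟨r, rfl, hr, -, hc⟩
    · simp [gapLength]
    · rw [gapLength_true_false_cons]
      exact (hc.even_gapLength hr).add even_two
termination_by s.length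

theorem not_pathEquiv_up_down {h : ℕ} {s t : List Bool}
    (hs : IsCanonicalFrom h (false :: true :: s)) (ht : IsCanonicalFrom h (false :: false :: t)) :
    ¬ PathEquiv [true, true, true] (true :: s) (false :: t) := by
  intro he
  have hse := hs.even_gapLength (by simp)
  rcases isCanonicalFrom_after_down hs with ⟨r, rfl⟩ | ⟨r, rfl, hr, hh, hc⟩
  · simp [pathEquiv_cons_cons] at he
  · have ht2 : IsCanonicalFrom (h - 1) (false :: t) := ht.2.2.2.2.2.2
    have hh1 : h - 1 - 1 = 0 := by omega
    have htD : ¬ [false] <+: t := by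
      rintro ⟨u, rfl⟩
      have h0 : 1 ≤ h - 1 - 1 := ht2.2.2.2.2.2.2.1
      omega
    have hte := ht2.even_gapLength htD
    rw [he.gapLength_eq, gapLength_false_cons] at hse
    exact (Nat.even_add_one.1 hse) hte

mutual

theorem IsCanonicalFrom.eq_of_pathEquiv_after_down {h : ℕ} {s t : List Bool}
    (hs : IsCanonicalFrom h (false :: s)) (ht : IsCanonicalFrom h (false :: t))
    (he : PathEquiv [true, true, true] s t) : s = t := by
  match s, t with
  | [], [] => rfl
  | [], _ :: _ => exact absurd he not_pathEquiv_nil_cons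
  | _ :: _, [] => exact absurd he not_pathEquiv_cons_nil
  | false :: s, false :: t =>
    rw [IsCanonicalFrom.eq_of_pathEquiv_after_down hs.2.2.2.2.2.2 ht.2.2.2.2.2.2
      (pathEquiv_cons_cons.1 he).2]
  | true :: s, false :: t => exact absurd he (not_pathEquiv_up_down hs ht)
  | false :: s, true :: t => exact absurd he.symm (not_pathEquiv_up_down ht hs)
  | true :: s, true :: t =>
    have hs' : IsCanonicalFrom (h - 1 + 1) s := hs.2.2.2.2.2.2
    have ht' : IsCanonicalFrom (h - 1 + 1) t := ht.2.2.2.2.2.2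
    rcases isCanonicalFrom_after_down hs with ⟨r, rfl⟩ | ⟨r, rfl, -, -, hr⟩ <;>
      rcases isCanonicalFrom_after_down ht with ⟨u, rfl⟩ | ⟨u, rfl, -, -, hu⟩
    · rw [IsCanonicalFrom.eq_of_pathEquiv_after_up_up (s := r) (t := u) hs' ht'
        (pathEquiv_cons_cons.1 he).2]
    · simp [pathEquiv_cons_cons] at he
    · simp [pathEquiv_cons_cons] at he
    · rw [IsCanonicalFrom.eq_of_pathEquiv_after_down hr hu
        (pathEquiv_cons_cons.1 (pathEquiv_cons_cons.1 he).2).2]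
termination_by s.length

theorem IsCanonicalFrom.eq_of_pathEquiv_after_up_up {h : ℕ} {s t : List Bool}
    (hs : IsCanonicalFrom h s) (ht : IsCanonicalFrom h t)
    (he : PathEquiv [true, true, true] (true :: true :: s) (true :: true :: t)) : s = t := by
  have he' := (pathEquiv_cons_cons.1 (pathEquiv_cons_cons.1 he).2).2
  match s, t with
  | [], [] => rfl
  | [], _ :: _ => exact absurd he' not_pathEquiv_nil_cons
  | _ :: _, [] => exact absurd he' not_pathEquiv_cons_nil
  | false :: s, false :: t =>
    rw [IsCanonicalFrom.eq_of_pathEquiv_after_down hs ht (pathEquiv_cons_cons.1 he').2]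
  | true :: s, false :: t => simp [pathEquiv_cons_cons] at he
  | false :: s, true :: t => simp [pathEquiv_cons_cons] at he
  | true :: s, true :: t =>
    have hs' : IsCanonicalFrom (h + 1) s := hs
    have ht' : IsCanonicalFrom (h + 1) t := ht
    rw [IsCanonicalFrom.eq_of_pathEquiv_after_up_up hs' ht' (pathEquiv_cons_cons.1 he).2]
termination_by s.length

end

/-- Canonical representatives, in terms of the stepwise conditions. -/
def IsCanonical (p : List Bool) : Prop :=
  IsCanonicalFrom 0 p ∧ ¬ [true, true, false, false] <+: p ∧ p ≠ [true, true]

theorem IsCanonical.cases {p : List Bool} (hp : IsCanonical p) :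
    p = [] ∨ p = [true] ∨ (∃ r, p = true :: true :: true :: r ∧ IsCanonicalFrom 3 r) ∨
      (∃ r, p = true :: false :: r ∧ IsCanonicalFrom 1 (false :: r) ∧ ¬ [false] <+: r) ∨
      ∃ r, p = true :: true :: false :: r ∧ IsCanonicalFrom 2 (false :: r) ∧
        ¬ [false] <+: r := by
  obtain ⟨h1, h2, h3⟩ := hp
  match p with
  | [] => simp
  | [true] => simp
  | [true, true] => simp at h3
  | true :: true :: true :: r => exact .inr (.inr (.inl ⟨r, rfl, h1⟩))
  | true :: true :: false :: r =>
    exact .inr (.inr (.inr (.inr ⟨r, rfl, h1, by simpa using h2⟩)))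
  | true :: false :: r =>
    refine .inr (.inr (.inr (.inl ⟨r, rfl, h1, ?_⟩)))
    rintro ⟨u, rfl⟩
    simp [IsCanonicalFrom] at h1
  | false :: r => simp [IsCanonicalFrom] at h1

theorem IsCanonical.eq_of_pathEquiv {p q : List Bool} (hp : IsCanonical p) (hq : IsCanonical q)
    (he : PathEquiv [true, true, true] p q) : p = q := by
  have hl := he.1
  have hg := he.gapLength_eq
  rcases hp.cases with rfl | rfl | ⟨r, rfl, hr⟩ | ⟨r, rfl, hr, hD⟩ | ⟨r, rfl, hr, hD⟩ <;>
    rcases hq.cases with rfl | rfl | ⟨u, rfl, hu⟩ | ⟨u, rfl, hu, hE⟩ | ⟨u, rfl, hu, hE⟩ <;>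
    first
    | rfl
    | (simp at hl; done)
    | (simp [pathEquiv_cons_cons] at he; done)
    | skip
  · rw [hr.eq_of_pathEquiv_after_up_up hu (pathEquiv_cons_cons.1 he).2]
  · rw [hr.eq_of_pathEquiv_after_down hu (pathEquiv_cons_cons.1 (pathEquiv_cons_cons.1 he).2).2]
  · have h1 := hr.even_gapLength hD
    have h2 := hu.even_gapLength hE
    simp [gapLength] at hg
    grind
  · have h1 := hr.even_gapLength hD
    have h2 := hu.even_gapLength hE
    simp [gapLength] at hg
    grind
  · rw [hr.eq_of_pathEquiv_after_down hu
      (pathEquiv_cons_cons.1 (pathEquiv_cons_cons.1 (pathEquiv_cons_cons.1 he).2).2).2]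

mutual

theorem exists_isCanonicalFrom_of_even (r : List Bool) {h : ℕ} (hh : h ≤ 1)
    (hg : Even (gapLength r)) :
    ∃ s, IsCanonicalFrom (h + 1) (false :: s) ∧ ¬ [false] <+: s ∧
      PathEquiv [true, true, true] r s := by
  rcases hk : gapLength r with _ | _ | k
  · rcases gapLength_eq_zero hk with rfl | ⟨u, rfl⟩
    · exact ⟨[], by simp [IsCanonicalFrom], by simp, pathEquiv_refl _ _⟩
    · obtain ⟨s, hs, he⟩ := exists_isCanonicalFrom_after_up_up u (h := h + 3) (by omega)
      exact ⟨true :: true :: true :: s, by simpa [IsCanonicalFrom] using hs, by simp,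
        pathEquiv_cons_cons.2 ⟨by simp, he⟩⟩
  · rw [hk] at hg
    simp at hg
  · obtain ⟨a, u, rfl, ha, hu⟩ := gapLength_eq_succ hk
    obtain ⟨b, v, rfl, hb, hv⟩ := gapLength_eq_succ hu
    obtain ⟨s, hs, hD, he⟩ := exists_isCanonicalFrom_of_even v hh (by grind)
    refine ⟨true :: false :: s, ?_, by simp, ?_⟩
    · have hs' := hs
      simp only [IsCanonicalFrom] at hs ⊢
      simp_all
    · exact pathEquiv_cons_cons.2 ⟨by simp [ha], pathEquiv_cons_cons.2 ⟨by simp [hb], he⟩⟩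
termination_by 2 * r.length

theorem exists_isCanonicalFrom_after_down (r : List Bool) (h : ℕ) :
    ∃ s, IsCanonicalFrom (h + 2) (false :: s) ∧ PathEquiv [true, true, true] r s := by
  rcases hk : gapLength r with _ | k
  · rcases gapLength_eq_zero hk with rfl | ⟨u, rfl⟩
    · exact ⟨[], by simp [IsCanonicalFrom], pathEquiv_refl _ _⟩
    · obtain ⟨s, hs, he⟩ := exists_isCanonicalFrom_after_up_up u (h := h + 4) (by omega)
      exact ⟨true :: true :: true :: s, by simpa [IsCanonicalFrom] using hs,
        pathEquiv_cons_cons.2 ⟨by simp, he⟩⟩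
  · cases h with
    | zero =>
      by_cases hg : Even (gapLength r)
      · obtain ⟨s, hs, -, he⟩ := exists_isCanonicalFrom_of_even r le_rfl hg
        exact ⟨s, hs, he⟩
      · obtain ⟨a, u, rfl, ha, hu⟩ := gapLength_eq_succ hk
        obtain ⟨s, hs, -, he⟩ := exists_isCanonicalFrom_of_even u (h := 0) (by simp) (by grind)
        exact ⟨false :: s, by simpa [IsCanonicalFrom] using hs,
          pathEquiv_cons_cons.2 ⟨by simp [ha], he⟩⟩
    | succ h =>
      obtain ⟨a, u, rfl, ha, hu⟩ := gapLength_eq_succ hk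
      obtain ⟨s, hs, he⟩ := exists_isCanonicalFrom_after_down u h
      exact ⟨false :: s, by simpa [IsCanonicalFrom] using hs,
        pathEquiv_cons_cons.2 ⟨by simp [ha], he⟩⟩
termination_by 2 * r.length + 1

theorem exists_isCanonicalFrom_after_up_up (r : List Bool) {h : ℕ} (hh : 2 ≤ h) :
    ∃ s, IsCanonicalFrom h s ∧
      PathEquiv [true, true, true] (true :: true :: r) (true :: true :: s) := by
  match r with
  | [] => exact ⟨[], trivial, pathEquiv_refl _ _⟩
  | true :: r =>
    obtain ⟨s, hs, he⟩ := exists_isCanonicalFrom_after_up_up r (h := h + 1) (by omega)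
    exact ⟨true :: s, hs, pathEquiv_cons_cons.2 ⟨by simp, he⟩⟩
  | false :: r =>
    obtain ⟨k, rfl⟩ := Nat.exists_eq_add_of_le' hh
    obtain ⟨s, hs, he⟩ := exists_isCanonicalFrom_after_down r k
    exact ⟨false :: s, hs, by simpa [pathEquiv_cons_cons] using he⟩
termination_by 2 * r.length

end

theorem exists_isCanonical {p : List Bool} (hp : IsBallot p) :
    ∃ q, IsCanonical q ∧ PathEquiv [true, true, true] p q := by
  have hhead : ¬ [false] <+: p := by
    rintro ⟨u, rfl⟩
    simpa using hp 1
  rcases hk : gapLength p with _ | _ | k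
  · rcases gapLength_eq_zero hk with rfl | ⟨u, rfl⟩
    · exact ⟨[], by simp [IsCanonical, IsCanonicalFrom], pathEquiv_refl _ _⟩
    · obtain ⟨s, hs, he⟩ := exists_isCanonicalFrom_after_up_up u (h := 3) (by omega)
      exact ⟨true :: true :: true :: s, by simpa [IsCanonical, IsCanonicalFrom] using hs,
        pathEquiv_cons_cons.2 ⟨by simp, he⟩⟩
  · obtain ⟨a, u, rfl, ha, hu⟩ := gapLength_eq_succ hk
    obtain rfl : a = true := by simpa using hhead
    rcases gapLength_eq_zero hu with rfl | ⟨v, rfl⟩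
    · exact ⟨[true], by simp [IsCanonical, IsCanonicalFrom], pathEquiv_refl _ _⟩
    · simp at ha
  · obtain ⟨a, u, rfl, ha, hu⟩ := gapLength_eq_succ hk
    obtain ⟨b, v, rfl, hb, hv⟩ := gapLength_eq_succ hu
    by_cases hg : Even k
    · obtain ⟨s, hs, hD, he⟩ := exists_isCanonicalFrom_of_even v (h := 0) (by simp) (by rwa [hv])
      exact ⟨true :: false :: s, ⟨hs, by simp, by simp⟩,
        pathEquiv_cons_cons.2 ⟨by simp [ha], pathEquiv_cons_cons.2 ⟨by simp [hb], he⟩⟩⟩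
    · obtain ⟨k, rfl⟩ := Nat.exists_eq_succ_of_ne_zero (n := k) (by rintro rfl; simp at hg)
      obtain ⟨c, w, rfl, hc, hw⟩ := gapLength_eq_succ hv
      obtain ⟨s, hs, hD, he⟩ := exists_isCanonicalFrom_of_even w (h := 1) (by simp) (by grind)
      exact ⟨true :: true :: false :: s, ⟨hs, by simpa using hD, by simp⟩,
        pathEquiv_cons_cons.2 ⟨by simp [ha], pathEquiv_cons_cons.2 ⟨by simp [hb],
          pathEquiv_cons_cons.2 ⟨by simp [hc], he⟩⟩⟩⟩

theorem pathHeight_zero (p : List Bool) : pathHeight p 0 = 0 := by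
  simp [pathHeight]

theorem pathHeight_cons_succ (a : Bool) (p : List Bool) (j : ℕ) :
    pathHeight (a :: p) (j + 1) = pathHeight p j + if a then 1 else -1 := by
  cases a <;> simp [pathHeight] <;> ring

theorem isBallot_iff_pathHeight {p : List Bool} : IsBallot p ↔ ∀ k, 0 ≤ pathHeight p k := by
  simp [IsBallot, pathHeight]

/-- The height condition on occurrences of DUD, for a path starting at height `h`. -/
def DUDLowFrom (h : ℕ) (p : List Bool) : Prop :=
  ∀ i, OccursAt [false, true, false] p i →
    ∃ j, i ≤ j ∧ j ≤ i + 3 ∧ (h : ℤ) + pathHeight p j ≤ 1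

theorem forall_pathHeight_cons_true {h : ℕ} {p : List Bool} :
    (∀ k, 0 ≤ (h : ℤ) + pathHeight (true :: p) k) ↔
      ∀ k, 0 ≤ ((h + 1 : ℕ) : ℤ) + pathHeight p k := by
  constructor
  · intro H k
    have := H (k + 1)
    rw [pathHeight_cons_succ] at this
    push_cast
    simp at this
    linarith
  · rintro H (_ | k)
    · simp [pathHeight_zero]
    · have := H k
      rw [pathHeight_cons_succ]
      push_cast at this
      simp
      linarith

theorem forall_pathHeight_cons_false {h : ℕ} {p : List Bool} :
    (∀ k, 0 ≤ (h : ℤ) + pathHeight (false :: p) k) ↔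
      1 ≤ h ∧ ∀ k, 0 ≤ ((h - 1 : ℕ) : ℤ) + pathHeight p k := by
  constructor
  · intro H
    have h1 : 1 ≤ h := by
      have := H 1
      rw [pathHeight_cons_succ, pathHeight_zero] at this
      simp at this
      omega
    refine ⟨h1, fun k => ?_⟩
    have := H (k + 1)
    rw [pathHeight_cons_succ] at this
    push_cast [h1]
    simp at this
    linarith
  · rintro ⟨h1, H⟩ (_ | k)
    · simp [pathHeight_zero]
    · have := H k
      rw [pathHeight_cons_succ]
      push_cast [h1] at this
      simp
      linarith

theorem dudLowFrom_cons_true {h : ℕ} {p : List Bool} :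
    DUDLowFrom h (true :: p) ↔ DUDLowFrom (h + 1) p := by
  constructor
  · intro H i hi
    obtain ⟨j, h1, h2, h3⟩ := H (i + 1) ((occursAt_cons_succ _ _ _ _).2 hi)
    obtain ⟨j, rfl⟩ := Nat.exists_eq_add_of_le' (show 1 ≤ j by omega)
    refine ⟨j, by omega, by omega, ?_⟩
    rw [pathHeight_cons_succ] at h3
    simp at h3
    push_cast
    linarith
  · rintro H (_ | i) hi
    · simp [occursAt_zero] at hi
    · obtain ⟨j, h1, h2, h3⟩ := H i ((occursAt_cons_succ _ _ _ _).1 hi)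
      refine ⟨j + 1, by omega, by omega, ?_⟩
      rw [pathHeight_cons_succ]
      push_cast at h3
      simp
      linarith

theorem dudLowFrom_cons_false {h : ℕ} {p : List Bool} (hh : 1 ≤ h) :
    DUDLowFrom h (false :: p) ↔
      (h ≤ 2 ∨ ¬ [true, false] <+: p) ∧ DUDLowFrom (h - 1) p := by
  constructor
  · intro H
    refine ⟨?_, fun i hi => ?_⟩
    · by_contra! hc
      obtain ⟨hc, u, rfl⟩ := hc
      obtain ⟨j, h1, h2, h3⟩ := H 0 (by simp [OccursAt])
      interval_cases j <;> simp [pathHeight] at h3 <;> omega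
    · obtain ⟨j, h1, h2, h3⟩ := H (i + 1) ((occursAt_cons_succ _ _ _ _).2 hi)
      obtain ⟨j, rfl⟩ := Nat.exists_eq_add_of_le' (show 1 ≤ j by omega)
      refine ⟨j, by omega, by omega, ?_⟩
      rw [pathHeight_cons_succ] at h3
      simp at h3
      push_cast [hh]
      linarith
  · rintro ⟨H0, H⟩ (_ | i) hi
    · refine ⟨1, by omega, by omega, ?_⟩
      rw [occursAt_zero] at hi
      have : h ≤ 2 := by simpa [hi] using H0.resolve_right (by simpa using hi)
      rw [pathHeight_cons_succ, pathHeight_zero]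
      simp
      omega
    · obtain ⟨j, h1, h2, h3⟩ := H i ((occursAt_cons_succ _ _ _ _).1 hi)
      refine ⟨j + 1, by omega, by omega, ?_⟩
      rw [pathHeight_cons_succ]
      push_cast [hh] at h3
      simp
      linarith

theorem isCanonicalFrom_iff {h : ℕ} {p : List Bool} :
    IsCanonicalFrom h p ↔ (∀ k, 0 ≤ (h : ℤ) + pathHeight p k) ∧
      ¬ [false, true, false, false] <:+: p ∧ ¬ [false, true, true, false] <:+: p ∧
      DUDLowFrom h p ∧ ¬ [false, true] <:+ p ∧ ¬ [false, true, true] <:+ p := by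
  induction p generalizing h with
  | nil => simp [IsCanonicalFrom, pathHeight, DUDLowFrom, OccursAt]
  | cons a p ih =>
    cases a with
    | true =>
      rw [forall_pathHeight_cons_true, dudLowFrom_cons_true]
      simp [IsCanonicalFrom, ih, List.infix_cons_iff, List.suffix_cons_iff]
    | false =>
      rw [forall_pathHeight_cons_false]
      by_cases hh : 1 ≤ h
      · rw [dudLowFrom_cons_false hh]
        simp only [IsCanonicalFrom, ih, List.infix_cons_iff, List.suffix_cons_iff,
          List.cons_prefix_cons, List.cons.injEq]
        grind
      · simp [IsCanonicalFrom, hh]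

theorem ending_iff (p : List Bool) :
    ([true, true, true] <:+ p ∨ [false] <:+ p ∨ p = [] ∨ p = [true]) ↔
      ¬ [false, true] <:+ p ∧ ¬ [false, true, true] <:+ p ∧ p ≠ [true, true] := by
  obtain ⟨q, rfl⟩ := List.reverse_surjective p
  have h (l : List Bool) : l <:+ q.reverse ↔ l.reverse <+: q := by
    rw [← List.reverse_prefix, List.reverse_reverse]
  have h' (l : List Bool) : q.reverse = l ↔ q = l.reverse := List.reverse_eq_iff
  simp only [h, h', ne_eq]
  match q with
  | [] => simp
  | [a] => cases a <;> simp
  | [a, b] => cases a <;> cases b <;> simp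
  | a :: b :: c :: l => cases a <;> cases b <;> cases c <;> simp

theorem isCanonical_iff {p : List Bool} :
    IsCanonical p ↔ IsBallot p ∧
      ¬ [true, true, false, false] <+: p ∧
      ¬ [false, true, false, false] <:+: p ∧
      ¬ [false, true, true, false] <:+: p ∧
      (∀ i : ℕ, OccursAt [false, true, false] p i →
        ∃ j : ℕ, i ≤ j ∧ j ≤ i + 3 ∧ pathHeight p j ≤ 1) ∧
      ([true, true, true] <:+ p ∨ [false] <:+ p ∨ p = [] ∨ p = [true]) := by
  rw [IsCanonical, isCanonicalFrom_iff, ending_iff, isBallot_iff_pathHeight]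
  simp only [DUDLowFrom, Nat.cast_zero, zero_add]
  tauto

/-- every ballot path of length `n` is UUU-equivalent to a unique ballot
path of length `n` not beginning with UUDD, avoiding DUDD and DUUD, avoiding DUD at
height greater than 1, and ending with UUU or with D, unless it is empty or equal
to U. -/
theorem uuu_unique_representative (n : ℕ) (p : List Bool)
    (hp : IsBallot p) (hlen : p.length = n) :
    ∃! p' : List Bool, IsBallot p' ∧ p'.length = n ∧
      PathEquiv [true, true, true] p p' ∧
      ¬ [true, true, false, false] <+: p' ∧
      ¬ [false, true, false, false] <:+: p' ∧
      ¬ [false, true, true, false] <:+: p' ∧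
      (∀ i : ℕ, OccursAt [false, true, false] p' i →
        ∃ j : ℕ, i ≤ j ∧ j ≤ i + 3 ∧ pathHeight p' j ≤ 1) ∧
      ([true, true, true] <:+ p' ∨ [false] <:+ p' ∨ p' = [] ∨ p' = [true]) := by
  obtain ⟨q, hq, he⟩ := exists_isCanonical hp
  obtain ⟨h1, h2⟩ := isCanonical_iff.1 hq
  refine ⟨q, ⟨h1, he.1.symm.trans hlen, he, h2⟩, ?_⟩
  rintro q' ⟨h1', -, he', h2'⟩
  exact (isCanonical_iff.2 ⟨h1', h2'⟩).eq_of_pathEquiv hq (he'.symm.trans he)
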